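/- Let n ≥ 1, let q be an indeterminate (or an element of a field of characteristic zero), and let a be an integer with 0 < a < n. Then ∑_{ζ^n=1} ζ^a / ((1−ζq)(1−ζ⁻¹q)) = n·(q^a + q^{n−a}) / ((1−q²)(1−q^n)) as an identity of rational functions over ℂ, where the sum is over all complex n-th roots of unity ζ. -/

import Mathlib

open Finset

/-- The primitive `n`-th root of unity `ω = e^{2πi/n}`. -/
noncomputable def omega (n : ℕ) : ℂ := Complex.exp (2 * Real.pi * Complex.I / n)

/-- Orthogonality: the `m`-th power sum of the `n`-th roots of unity vanishes unless `n ∣ m`. -/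
theorem sum_pow_primitiveRoot_eq_zero {n m : ℕ} {w : ℂ} (hw : IsPrimitiveRoot w n)
    (hm : ¬ n ∣ m) : ∑ j ∈ Finset.range n, (w ^ j) ^ m = 0 := by
  have h1 : w ^ m ≠ 1 := fun h => hm (hw.dvd_of_pow_eq_one m h)
  have h2 : (∑ j ∈ Finset.range n, (w ^ m) ^ j) * (w ^ m - 1) = 0 := by
    rw [geom_sum_mul, ← pow_mul, mul_comm m n, pow_mul, hw.pow_eq_one, one_pow, sub_self]
  rw [← (mul_eq_zero.mp h2).resolve_right (sub_ne_zero.mpr h1)]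
  exact Finset.sum_congr rfl fun j _ => by rw [← pow_mul, ← pow_mul, mul_comm]

theorem one_sub_mul_ne_zero_of_pow_eq_one {n : ℕ} {z q : ℂ} (hz : z ^ n = 1) (hq : q ^ n ≠ 1) :
    1 - z * q ≠ 0 := by
  intro h
  apply hq
  rw [← one_mul (q ^ n), ← hz, ← mul_pow, ← sub_eq_zero.mp h, one_pow, hz]

theorem sum_pow_div_one_sub_primitiveRoot_mul {n a : ℕ} {w q : ℂ} (hw : IsPrimitiveRoot w n)
    (ha0 : 0 < a) (ha : a < n) (hq : q ^ n ≠ 1) :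
    ∑ j ∈ Finset.range n, (w ^ j) ^ a / (1 - w ^ j * q) = n * q ^ (n - a) / (1 - q ^ n) := by
  have hqn : 1 - q ^ n ≠ 0 := sub_ne_zero.mpr hq.symm
  have hz (j : ℕ) : (w ^ j) ^ n = 1 := by rw [pow_right_comm, hw.pow_eq_one, one_pow]
  have expand (j : ℕ) : (w ^ j) ^ a / (1 - w ^ j * q)
      = (∑ k ∈ Finset.range n, q ^ k * (w ^ j) ^ (a + k)) / (1 - q ^ n) := by
    rw [div_eq_div_iff (one_sub_mul_ne_zero_of_pow_eq_one (hz j) hq) hqn]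
    have h := geom_sum_mul_neg (w ^ j * q) n
    rw [mul_pow, hz, one_mul] at h
    rw [← h, ← mul_assoc, Finset.mul_sum]
    congr 1
    exact Finset.sum_congr rfl fun k _ => by rw [mul_pow, pow_add]; ring
  simp_rw [expand]
  rw [← Finset.sum_div, Finset.sum_comm]
  congr 1
  rw [Finset.sum_eq_single (n - a)]
  · rw [← Finset.mul_sum, Nat.add_sub_cancel' ha.le]
    simp [hz, mul_comm]
  · intro k hk hne
    rw [← Finset.mul_sum, sum_pow_primitiveRoot_eq_zero hw, mul_zero]
    rintro ⟨c, hc⟩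
    have hk := Finset.mem_range.mp hk
    have hc1 : c = 1 := by
      have : c < 2 := by by_contra! h; nlinarith
      have : c ≠ 0 := by rintro rfl; omega
      omega
    subst hc1
    omega
  · intro h
    exact absurd (Finset.mem_range.mpr (by omega)) h

/-- Lemma 4.1: for `0 < a < n`,
`∑_{ζ^n=1} ζ^a/((1-ζq)(1-ζ⁻¹q)) = n (q^a + q^{n-a}) / ((1-q²)(1-q^n))`,
the sum being over all complex `n`-th roots of unity, for every complex `q`
avoiding the poles. -/
theorem stmt1 (n a : ℕ) (hn : 1 ≤ n) (ha0 : 0 < a) (ha : a < n)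
    (q : ℂ) (hq : q ^ n ≠ 1) (hq2 : q ^ 2 ≠ 1) :
    ∑ j ∈ Finset.range n,
      ((omega n) ^ j) ^ a /
        ((1 - (omega n) ^ j * q) * (1 - ((omega n) ^ j)⁻¹ * q))
      = (n : ℂ) * (q ^ a + q ^ (n - a)) / ((1 - q ^ 2) * (1 - q ^ n)) := by
  have hw : IsPrimitiveRoot (omega n) n := Complex.isPrimitiveRoot_exp n (by omega)
  set w := omega n
  have hz (j : ℕ) : (w ^ j) ^ n = 1 := by rw [pow_right_comm, hw.pow_eq_one, one_pow]
  have hz0 (j : ℕ) : w ^ j ≠ 0 := pow_ne_zero _ (hw.ne_zero (by omega))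
  have hqn : 1 - q ^ n ≠ 0 := sub_ne_zero.mpr hq.symm
  have hq2' : 1 - q ^ 2 ≠ 0 := sub_ne_zero.mpr hq2.symm
  have split (j : ℕ) : (w ^ j) ^ a / ((1 - w ^ j * q) * (1 - (w ^ j)⁻¹ * q))
      = ((w ^ j) ^ a / (1 - w ^ j * q) + (w⁻¹ ^ j) ^ (n - a) / (1 - w⁻¹ ^ j * q)
          - (w ^ j) ^ a) / (1 - q ^ 2) := by
    have hinv : (w⁻¹ ^ j) ^ (n - a) = (w ^ j) ^ a := by
      rw [inv_pow, inv_pow]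
      apply inv_eq_of_mul_eq_one_right
      rw [← pow_add, Nat.sub_add_cancel ha.le, hz]
    rw [hinv, inv_pow]
    have h1 := one_sub_mul_ne_zero_of_pow_eq_one (hz j) hq
    have h2 : 1 - (w ^ j)⁻¹ * q ≠ 0 :=
      one_sub_mul_ne_zero_of_pow_eq_one (by rw [inv_pow, hz, inv_one]) hq
    have h3 : w ^ j * (w ^ j)⁻¹ = 1 := mul_inv_cancel₀ (hz0 j)
    generalize (w ^ j)⁻¹ = y at *
    generalize w ^ j = x at *
    rw [div_add_div _ _ h1 h2, eq_div_iff hq2', div_mul_eq_mul_div, div_eq_iff (mul_ne_zero h1 h2),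
      sub_mul, div_mul_cancel₀ _ (mul_ne_zero h1 h2)]
    linear_combination q ^ 2 * x ^ a * h3
  simp_rw [split]
  rw [← Finset.sum_div, Finset.sum_sub_distrib, Finset.sum_add_distrib,
    sum_pow_div_one_sub_primitiveRoot_mul hw ha0 ha hq,
    sum_pow_div_one_sub_primitiveRoot_mul hw.inv (by omega) (by omega) hq,
    sum_pow_primitiveRoot_eq_zero hw (Nat.not_dvd_of_pos_of_lt ha0 ha), Nat.sub_sub_self ha.le]
  field_simp
  ring
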